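/- arXiv:1811.02450 — 2 statements merged into one kernel-verified Lean document; each statement's English description precedes it below -/
import Mathlib

section
/- For every n ≥ 1, the constant κ(n) := ‖e₁∨⋯∨eₙ‖_{πs+} (computed in ℓ₁ⁿ) satisfies nⁿ/n! ≤ κ(n) ≤ 2^{n−1}·nⁿ/n!. -/
open scoped BigOperators TensorProduct
open PiTensorProduct

noncomputable section

/-- The projective tensor norm `‖·‖_π` on the `n`-th algebraic tensor power `E^⊗n`. -/
def projNorm {E : Type*} [NormedAddCommGroup E] [NormedSpace ℝ E] (n : ℕ)
    (t : ⨂[ℝ] (_ : Fin n), E) : ℝ :=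
  sInf {s : ℝ | ∃ (N : ℕ) (a : Fin N → ℝ) (x : Fin N → Fin n → E),
    t = ∑ k, a k • (⨂ₜ[ℝ] i, x k i) ∧ s = ∑ k, |a k| * ∏ i, ‖x k i‖}

/-- The positive projective tensor norm `‖·‖_{π+}` on `E^⊗n`: only decompositions into
elementary tensors of elements of the positive cone `P` are allowed. -/
def projNormPos {E : Type*} [NormedAddCommGroup E] [NormedSpace ℝ E] (P : Set E) (n : ℕ)
    (t : ⨂[ℝ] (_ : Fin n), E) : ℝ :=
  sInf {s : ℝ | ∃ (N : ℕ) (a : Fin N → ℝ) (x : Fin N → Fin n → E),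
    (∀ k i, x k i ∈ P) ∧ t = ∑ k, a k • (⨂ₜ[ℝ] i, x k i) ∧
    s = ∑ k, |a k| * ∏ i, ‖x k i‖}

/-- The symmetric projective tensor norm `‖·‖_{πs}` (decompositions into tensor powers). -/
def symProjNorm {E : Type*} [NormedAddCommGroup E] [NormedSpace ℝ E] (n : ℕ)
    (t : ⨂[ℝ] (_ : Fin n), E) : ℝ :=
  sInf {s : ℝ | ∃ (N : ℕ) (a : Fin N → ℝ) (x : Fin N → E),
    t = ∑ k, a k • (⨂ₜ[ℝ] (_ : Fin n), x k) ∧ s = ∑ k, |a k| * ‖x k‖ ^ n}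

/-- The positive symmetric projective tensor norm `‖·‖_{πs+}` (decompositions into tensor
powers of elements of the positive cone `P`). -/
def symProjNormPos {E : Type*} [NormedAddCommGroup E] [NormedSpace ℝ E] (P : Set E) (n : ℕ)
    (t : ⨂[ℝ] (_ : Fin n), E) : ℝ :=
  sInf {s : ℝ | ∃ (N : ℕ) (a : Fin N → ℝ) (x : Fin N → E),
    (∀ k, x k ∈ P) ∧ t = ∑ k, a k • (⨂ₜ[ℝ] (_ : Fin n), x k) ∧
    s = ∑ k, |a k| * ‖x k‖ ^ n}

/-- `‖x‖₊ = inf{‖y‖+‖z‖ : x = y − z, y,z ∈ P}`. -/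
def normPlus {E : Type*} [NormedAddCommGroup E] (P : Set E) (x : E) : ℝ :=
  sInf {r : ℝ | ∃ y ∈ P, ∃ z ∈ P, x = y - z ∧ r = ‖y‖ + ‖z‖}

/-- `c₊(E) = sup{‖x‖₊ : ‖x‖ ≤ 1}`. -/
def cPlus {E : Type*} [NormedAddCommGroup E] (P : Set E) : ℝ :=
  sSup {r : ℝ | ∃ x : E, ‖x‖ ≤ 1 ∧ r = normPlus P x}

/-- `P` is a closed generating cone in `E`, i.e. `E` with `P` is an ordered normed space
with `E = P − P`. -/
def IsGenCone {E : Type*} [NormedAddCommGroup E] [NormedSpace ℝ E] (P : Set E) : Prop :=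
  IsClosed P ∧ (∀ x ∈ P, ∀ y ∈ P, x + y ∈ P) ∧
    (∀ (c : ℝ), 0 ≤ c → ∀ x ∈ P, c • x ∈ P) ∧
    ∀ x : E, ∃ y ∈ P, ∃ z ∈ P, x = y - z

/-- `c₊(E)` is finite. -/
def CPlusFinite {E : Type*} [NormedAddCommGroup E] (P : Set E) : Prop :=
  BddAbove {r : ℝ | ∃ x : E, ‖x‖ ≤ 1 ∧ r = normPlus P x}

/-- The `j`-th standard basis vector of `ℓ₁^m`. -/
def l1e (m : ℕ) (j : Fin m) : PiLp 1 fun _ : Fin m => ℝ :=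
  (WithLp.equiv 1 (Fin m → ℝ)).symm (Pi.single j 1)

/-- The positive cone of coordinatewise nonnegative vectors in `ℓ₁^m`. -/
def l1cone (m : ℕ) : Set (PiLp 1 fun _ : Fin m => ℝ) := {x | ∀ i, 0 ≤ x i}

/-- `κ(n) := ‖e₁ ∨ ⋯ ∨ eₙ‖_{πs+}` computed in `ℓ₁ⁿ`, where
`x₁ ∨ ⋯ ∨ xₙ = (1/n!)·Σ_{σ ∈ Sₙ} x_{σ(1)} ⊗ ⋯ ⊗ x_{σ(n)}`. -/
def kappa (n : ℕ) : ℝ :=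
  symProjNormPos (l1cone n) n
    ((n.factorial : ℝ)⁻¹ • ∑ σ : Equiv.Perm (Fin n), ⨂ₜ[ℝ] i, l1e n (σ i))

theorem aux_polar (n : ℕ) {E : Type*} [AddCommGroup E] [Module ℝ E] (e : Fin n → E) :
    ∑ σ : Equiv.Perm (Fin n), (⨂ₜ[ℝ] i, e (σ i)) =
      ∑ U : Finset (Fin n), ((-1 : ℝ) ^ U.card) • (⨂ₜ[ℝ] (_ : Fin n), ∑ j ∈ Uᶜ, e j) := by
  classical
  have h1 : ∀ U : Finset (Fin n), (⨂ₜ[ℝ] (_ : Fin n), ∑ j ∈ Uᶜ, e j) =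
      ∑ f : Fin n → Fin n, if U ⊆ (Finset.univ.image f)ᶜ then (⨂ₜ[ℝ] i, e (f i)) else 0 := by
    intro U
    have := MultilinearMap.map_sum_finset (PiTensorProduct.tprod ℝ (s := fun _ : Fin n => E))
      (fun _ j => e j) (fun _ : Fin n => Uᶜ)
    rw [this, ← Finset.sum_filter]
    apply Finset.sum_congr _ (fun _ _ => rfl)
    ext f
    simp only [Fintype.mem_piFinset, Finset.mem_compl, Finset.mem_filter, Finset.mem_univ,
      true_and, Finset.subset_iff, Finset.mem_image, not_exists]
    constructor
    · intro h a ha i hi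
      exact h i (hi ▸ ha)
    · intro h i hi
      exact h hi i rfl
  simp_rw [h1, Finset.smul_sum]
  rw [Finset.sum_comm]
  have h2 : ∀ f : Fin n → Fin n, (∑ U : Finset (Fin n), ((-1 : ℝ) ^ U.card) •
      (if U ⊆ (Finset.univ.image f)ᶜ then (⨂ₜ[ℝ] i, e (f i)) else 0)) =
      if Function.Bijective f then (⨂ₜ[ℝ] i, e (f i)) else 0 := by
    intro f
    simp_rw [smul_ite, smul_zero]
    rw [← Finset.sum_filter, ← Finset.sum_smul]
    have h3 : (Finset.univ.filter fun U : Finset (Fin n) => U ⊆ (Finset.univ.image f)ᶜ) =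
        ((Finset.univ.image f)ᶜ).powerset := by
      ext; simp
    have h4 : (∑ U ∈ ((Finset.univ.image f)ᶜ).powerset, (-1 : ℝ) ^ U.card) =
        if (Finset.univ.image f)ᶜ = ∅ then 1 else 0 := by
      have := Finset.sum_powerset_neg_one_pow_card (x := (Finset.univ.image f)ᶜ)
      exact_mod_cast congrArg (Int.cast : ℤ → ℝ) this
    have h5 : (Finset.univ.image f)ᶜ = ∅ ↔ Function.Bijective f := by
      rw [← Finite.surjective_iff_bijective, Finset.compl_eq_empty_iff,
        Finset.eq_univ_iff_forall]
      simp [Function.Surjective]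
    rw [h3, h4]
    simp only [h5]
    split_ifs <;> simp
  simp_rw [h2]
  rw [← Finset.sum_filter]
  refine Finset.sum_bij (fun σ _ => (σ : Fin n → Fin n)) ?_ ?_ ?_ ?_
  · intro σ _
    exact Finset.mem_filter.2 ⟨Finset.mem_univ _, σ.bijective⟩
  · intro a _ b _ h
    exact DFunLike.coe_injective h
  · intro f hf
    exact ⟨Equiv.ofBijective f (Finset.mem_filter.1 hf).2, Finset.mem_univ _, rfl⟩
  · intro _ _; rfl

theorem aux_norm (n : ℕ) (x : PiLp 1 fun _ : Fin n => ℝ) (hx : x ∈ l1cone n) :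
    ‖x‖ = ∑ i, x i := by
  rw [PiLp.norm_eq_of_L1]
  exact Finset.sum_congr rfl fun i _ => by rw [Real.norm_eq_abs, abs_of_nonneg (hx i)]

theorem aux_coord (n : ℕ) (U : Finset (Fin n)) (i : Fin n) :
    (∑ j ∈ Uᶜ, l1e n j) i = if i ∈ Uᶜ then 1 else 0 := by
  classical
  rw [WithLp.ofLp_sum, Finset.sum_apply]
  simp [l1e]

theorem aux_cone (n : ℕ) (U : Finset (Fin n)) : (∑ j ∈ Uᶜ, l1e n j) ∈ l1cone n := by
  intro i
  rw [aux_coord]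
  split_ifs <;> norm_num

theorem aux_count (n : ℕ) (hn : 1 ≤ n) :
    ∑ U : Finset (Fin n), ((Uᶜ.card : ℝ)) ^ n ≤ 2 ^ (n - 1) * (n : ℝ) ^ n := by
  have h1 : ∑ U : Finset (Fin n), ((Uᶜ.card : ℝ)) ^ n =
      ∑ U : Finset (Fin n), ((U.card : ℝ)) ^ n :=
    Fintype.sum_equiv (Function.Involutive.toPerm (fun U : Finset (Fin n) => Uᶜ) compl_involutive) _ _ (fun _ => rfl)
  have h2 : ∑ U : Finset (Fin n), (((U.card : ℝ)) ^ n + ((Uᶜ.card : ℝ)) ^ n) ≤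
      ∑ U : Finset (Fin n), (n : ℝ) ^ n := by
    apply Finset.sum_le_sum
    intro U _
    have := pow_add_pow_le (Nat.cast_nonneg (α := ℝ) U.card) (Nat.cast_nonneg (α := ℝ) Uᶜ.card)
      (n := n) (by omega)
    have h := Finset.card_add_card_compl U
    rw [Fintype.card_fin] at h
    rw [← Nat.cast_add, h] at this
    exact this
  rw [Finset.sum_add_distrib, ← h1] at h2
  simp only [Finset.sum_const, Finset.card_univ, Fintype.card_finset, Fintype.card_fin,
    nsmul_eq_mul, Nat.cast_pow, Nat.cast_ofNat] at h2
  obtain ⟨m, rfl⟩ : ∃ m, n = m + 1 := ⟨n - 1, by omega⟩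
  rw [pow_succ (2 : ℝ) m] at h2
  simp only [Nat.add_sub_cancel]
  linarith

theorem aux_mem (n : ℕ) : (∑ U : Finset (Fin n), ((Uᶜ.card : ℝ)) ^ n) / n.factorial ∈
    {s : ℝ | ∃ (N : ℕ) (a : Fin N → ℝ) (x : Fin N → PiLp 1 fun _ : Fin n => ℝ),
    (∀ k, x k ∈ l1cone n) ∧
    ((n.factorial : ℝ)⁻¹ • ∑ σ : Equiv.Perm (Fin n), ⨂ₜ[ℝ] i, l1e n (σ i)) =
      ∑ k, a k • (⨂ₜ[ℝ] (_ : Fin n), x k) ∧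
    s = ∑ k, |a k| * ‖x k‖ ^ n} := by
  let E := (Fintype.equivFin (Finset (Fin n))).symm
  refine ⟨_, fun k => (n.factorial : ℝ)⁻¹ * (-1) ^ (E k).card,
    fun k => ∑ j ∈ (E k)ᶜ, l1e n j, fun k => aux_cone n _, ?_, ?_⟩
  · rw [aux_polar, Finset.smul_sum]
    simp_rw [smul_smul]
    exact (Equiv.sum_comp E (fun U => ((n.factorial : ℝ)⁻¹ * (-1) ^ U.card) •
      (⨂ₜ[ℝ] (_ : Fin n), ∑ j ∈ Uᶜ, l1e n j))).symm
  · rw [Equiv.sum_comp E (fun U => |(n.factorial : ℝ)⁻¹ * (-1) ^ U.card| *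
      ‖∑ j ∈ Uᶜ, l1e n j‖ ^ n), Finset.sum_div]
    refine Finset.sum_congr rfl fun U _ => ?_
    rw [aux_norm n _ (aux_cone n U)]
    simp_rw [aux_coord]
    rw [abs_mul, abs_pow, abs_neg, abs_one, one_pow, mul_one, abs_of_nonneg (by positivity)]
    rw [Finset.sum_ite_mem, Finset.univ_inter]
    simp [div_eq_inv_mul]

theorem aux_amgm (n : ℕ) (hn : 1 ≤ n) (x : PiLp 1 fun _ : Fin n => ℝ) (hx : x ∈ l1cone n) :
    (n : ℝ) ^ n * ∏ i, x i ≤ ‖x‖ ^ n := by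
  have hn0 : (0 : ℝ) < n := by exact_mod_cast hn
  rw [aux_norm n x hx]
  have h := Real.geom_mean_le_arith_mean Finset.univ (fun _ : Fin n => (1 : ℝ)) (fun i => x i)
    (fun _ _ => zero_le_one) (by simpa using hn0) (fun i _ => hx i)
  simp only [Real.rpow_one, Finset.sum_const, Finset.card_univ, Fintype.card_fin, nsmul_eq_mul,
    mul_one, one_mul] at h
  have hp : 0 ≤ ∏ i, x i := Finset.prod_nonneg fun i _ => hx i
  have h' := pow_le_pow_left₀ (Real.rpow_nonneg hp _) h n
  rw [Real.rpow_inv_natCast_pow hp (by omega), div_pow, le_div_iff₀ (by positivity)] at h'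
  linarith

theorem aux_lower (n : ℕ) (hn : 1 ≤ n) (N : ℕ) (a : Fin N → ℝ)
    (x : Fin N → PiLp 1 fun _ : Fin n => ℝ) (hx : ∀ k, x k ∈ l1cone n)
    (h : ((n.factorial : ℝ)⁻¹ • ∑ σ : Equiv.Perm (Fin n), ⨂ₜ[ℝ] i, l1e n (σ i)) =
      ∑ k, a k • (⨂ₜ[ℝ] (_ : Fin n), x k)) :
    (n : ℝ) ^ n / n.factorial ≤ ∑ k, |a k| * ‖x k‖ ^ n := by
  classical
  let φ : (⨂[ℝ] (_ : Fin n), PiLp 1 fun _ : Fin n => ℝ) →ₗ[ℝ] ℝ :=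
    PiTensorProduct.lift ((MultilinearMap.mkPiRing ℝ (Fin n) (1 : ℝ)).compLinearMap
      (fun i => (LinearMap.proj i : (Fin n → ℝ) →ₗ[ℝ] ℝ) ∘ₗ
        (WithLp.linearEquiv 1 ℝ (Fin n → ℝ)).toLinearMap))
  have hφ : ∀ y : Fin n → PiLp 1 fun _ : Fin n => ℝ, φ (⨂ₜ[ℝ] i, y i) = ∏ i, y i i := by
    intro y
    simp [φ]
  have h2 := congrArg φ h
  simp only [map_smul, map_sum, hφ, smul_eq_mul] at h2
  have h3 : ∑ σ : Equiv.Perm (Fin n), ∏ i, (l1e n (σ i)) i = 1 := by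
    rw [Finset.sum_eq_single 1]
    · simp [l1e]
    · intro σ _ hσ
      obtain ⟨i, hi⟩ : ∃ i, σ i ≠ i := by
        by_contra! hc
        exact hσ (Equiv.ext hc)
      exact Finset.prod_eq_zero (Finset.mem_univ i) (by simp [l1e, hi.symm])
    · simp
  rw [h3, mul_one] at h2
  rw [div_eq_mul_inv, h2, Finset.mul_sum]
  refine Finset.sum_le_sum fun k _ => ?_
  have hp : 0 ≤ ∏ i, (x k) i := Finset.prod_nonneg fun i _ => hx k i
  calc (n : ℝ) ^ n * (a k * ∏ i, (x k) i) = a k * ((n : ℝ) ^ n * ∏ i, (x k) i) := by ring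
    _ ≤ |a k| * ((n : ℝ) ^ n * ∏ i, (x k) i) :=
        mul_le_mul_of_nonneg_right (le_abs_self _) (by positivity)
    _ ≤ _ := mul_le_mul_of_nonneg_left (aux_amgm n hn _ (hx k)) (abs_nonneg _)

/-- `nⁿ/n! ≤ κ(n) ≤ 2^{n−1}·nⁿ/n!`. -/
theorem kappa_bounds (n : ℕ) (hn : 1 ≤ n) :
    (n : ℝ) ^ n / n.factorial ≤ kappa n ∧
      kappa n ≤ 2 ^ (n - 1) * ((n : ℝ) ^ n / n.factorial) := by
  have hmem := aux_mem n
  constructor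
  · refine le_csInf ⟨_, hmem⟩ ?_
    rintro s ⟨N, a, x, hx, h, rfl⟩
    exact aux_lower n hn N a x hx h
  · refine (csInf_le ⟨0, ?_⟩ hmem).trans ?_
    · rintro s ⟨N, a, x, hx, h, rfl⟩
      positivity
    · rw [← mul_div_assoc]
      exact div_le_div_of_nonneg_right (aux_count n hn) (by positivity)

end
end

section
/- Let 1 ≤ n ≤ N with N > n(n−1)/2. Then κ(n,N) ≤ 1 + (n(n−1)/(2N − n(n−1)))·(κ(n) + 1). -/
open scoped BigOperators TensorProduct
open PiTensorProduct

noncomputable section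

/-- `χ_{n,N} = ((N−n)!/N!)·Σ e_{i₁} ⊗ ⋯ ⊗ e_{iₙ}`, summed over all `n`-tuples of distinct
indices in `{1,…,N}`: the distribution of a sample of size `n` drawn from `{1,…,N}`
without replacement, as a symmetric tensor in `(ℓ₁^N)^⊗n`. -/
def chiTensor (n N : ℕ) : ⨂[ℝ] (_ : Fin n), PiLp 1 fun _ : Fin N => ℝ :=
  (((N - n).factorial : ℝ) / (N.factorial : ℝ)) •
    ∑ f : Fin n ↪ Fin N, ⨂ₜ[ℝ] j, l1e N (f j)

/-- `κ(n,N) := ‖χ_{n,N}‖_{πs+}` computed in `ℓ₁^N`. -/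
def kappaNN (n N : ℕ) : ℝ :=
  symProjNormPos (l1cone N) n (chiTensor n N)

/-- Decomposition of `t` of cost at most `s`. -/
def TRep {E : Type*} [NormedAddCommGroup E] [NormedSpace ℝ E] (P : Set E) (n : ℕ)
    (t : ⨂[ℝ] (_ : Fin n), E) (s : ℝ) : Prop :=
  ∃ (N : ℕ) (a : Fin N → ℝ) (x : Fin N → E),
    (∀ k, x k ∈ P) ∧ t = ∑ k, a k • (⨂ₜ[ℝ] (_ : Fin n), x k) ∧
    ∑ k, |a k| * ‖x k‖ ^ n ≤ s

section
variable {E F : Type*} [NormedAddCommGroup E] [NormedSpace ℝ E]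
  [NormedAddCommGroup F] [NormedSpace ℝ F] {P : Set E} {Q : Set F} {n : ℕ}

theorem TRep.norm_le {t : ⨂[ℝ] (_ : Fin n), E} {s : ℝ} (h : TRep P n t s) :
    symProjNormPos P n t ≤ s := by
  obtain ⟨m, a, x, hx, ht, hs⟩ := h
  refine le_trans (csInf_le ⟨0, ?_⟩ ⟨m, a, x, hx, ht, rfl⟩) hs
  rintro _ ⟨m, a, x, hx, ht, rfl⟩
  exact Finset.sum_nonneg fun k _ => by positivity

theorem le_norm_of_TRep {t : ⨂[ℝ] (_ : Fin n), E} {b : ℝ} (hne : ∃ s, TRep P n t s)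
    (h : ∀ s, TRep P n t s → b ≤ s) : b ≤ symProjNormPos P n t := by
  obtain ⟨s, m, a, x, hx, ht, hs⟩ := hne
  refine le_csInf ⟨_, m, a, x, hx, ht, rfl⟩ ?_
  rintro _ ⟨m, a, x, hx, ht, rfl⟩
  exact h _ ⟨m, a, x, hx, ht, le_rfl⟩

theorem TRep.nonneg {t : ⨂[ℝ] (_ : Fin n), E} {s : ℝ} (h : TRep P n t s) : 0 ≤ s := by
  obtain ⟨m, a, x, hx, ht, hs⟩ := h
  exact le_trans (Finset.sum_nonneg fun k _ => by positivity) hs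

theorem TRep.zero : TRep P n (0 : ⨂[ℝ] (_ : Fin n), E) 0 :=
  ⟨0, Fin.elim0, Fin.elim0, fun k => k.elim0, by simp, by simp⟩

theorem TRep.single {x : E} (hx : x ∈ P) : TRep P n (⨂ₜ[ℝ] (_ : Fin n), x) (‖x‖ ^ n) :=
  ⟨1, fun _ => 1, fun _ => x, fun _ => hx, by simp, by simp⟩

theorem TRep.mono {t : ⨂[ℝ] (_ : Fin n), E} {s s' : ℝ} (h : TRep P n t s) (hs : s ≤ s') :
    TRep P n t s' := by
  obtain ⟨m, a, x, hx, ht, h⟩ := h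
  exact ⟨m, a, x, hx, ht, h.trans hs⟩

theorem TRep.add {t t' : ⨂[ℝ] (_ : Fin n), E} {s s' : ℝ} (h : TRep P n t s) (h' : TRep P n t' s') :
    TRep P n (t + t') (s + s') := by
  obtain ⟨m, a, x, hx, ht, h⟩ := h
  obtain ⟨m', a', x', hx', ht', h'⟩ := h'
  refine ⟨m + m', Fin.append a a', Fin.append x x', ?_, ?_, ?_⟩
  · intro k
    refine Fin.addCases (fun i => ?_) (fun i => ?_) k
    · simpa using hx i
    · simpa using hx' i
  · simp [Fin.sum_univ_add, ht, ht']
  · simpa [Fin.sum_univ_add] using add_le_add h h'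

theorem TRep.smul {t : ⨂[ℝ] (_ : Fin n), E} {s : ℝ} (c : ℝ) (h : TRep P n t s) :
    TRep P n (c • t) (|c| * s) := by
  obtain ⟨m, a, x, hx, ht, h⟩ := h
  refine ⟨m, fun k => c * a k, x, hx, ?_, ?_⟩
  · simp [ht, Finset.smul_sum, mul_smul]
  · simp only [abs_mul, mul_assoc, ← Finset.mul_sum]
    exact mul_le_mul_of_nonneg_left h (abs_nonneg c)

theorem TRep.sum {ι : Type*} (A : Finset ι) (t : ι → ⨂[ℝ] (_ : Fin n), E) (s : ι → ℝ)
    (h : ∀ i ∈ A, TRep P n (t i) (s i)) : TRep P n (∑ i ∈ A, t i) (∑ i ∈ A, s i) := by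
  classical
  induction A using Finset.induction_on with
  | empty => simpa using TRep.zero
  | insert i A hi ih =>
    rw [Finset.sum_insert hi, Finset.sum_insert hi]
    exact (h i (by simp)).add (ih fun j hj => h j (by simp [hj]))

theorem TRep.map {t : ⨂[ℝ] (_ : Fin n), E} {s : ℝ} (h : TRep P n t s) (L : E →ₗ[ℝ] F)
    (hL : ∀ x ∈ P, L x ∈ Q) (hn : ∀ x, ‖L x‖ ≤ ‖x‖) :
    TRep Q n (PiTensorProduct.map (fun _ => L) t) s := by
  obtain ⟨m, a, x, hx, ht, h⟩ := h
  refine ⟨m, a, fun k => L (x k), fun k => hL _ (hx k), ?_, le_trans ?_ h⟩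
  · simp [ht, PiTensorProduct.map_tprod]
  · gcongr with k
    exact hn _

end

theorem l1e_apply (m : ℕ) (j i : Fin m) : l1e m j i = if i = j then 1 else 0 := by
  simp [l1e, Pi.single_apply]

theorem l1e_norm (m : ℕ) (j : Fin m) : ‖l1e m j‖ = 1 := by
  simp [PiLp.norm_eq_of_L1, l1e_apply, apply_ite norm]

/-- The map with `e_j ↦ e_{f j}`. -/
def pushMap (n N : ℕ) (f : Fin n → Fin N) :
    (PiLp 1 fun _ : Fin n => ℝ) →ₗ[ℝ] (PiLp 1 fun _ : Fin N => ℝ) where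
  toFun x := ∑ j, x j • l1e N (f j)
  map_add' x y := by simp [add_smul, Finset.sum_add_distrib]
  map_smul' c x := by simp [mul_smul, Finset.smul_sum]

theorem pushMap_apply (n N : ℕ) (f : Fin n → Fin N) (x) :
    pushMap n N f x = ∑ j, x j • l1e N (f j) := rfl

theorem pushMap_e (n N : ℕ) (f : Fin n → Fin N) (j : Fin n) :
    pushMap n N f (l1e n j) = l1e N (f j) := by
  simp [pushMap_apply, l1e_apply]

theorem sum_mem_cone {ι : Type*} (A : Finset ι) (N : ℕ) (c : ι → ℝ) (hc : ∀ i, 0 ≤ c i)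
    (f : ι → Fin N) : ∑ j ∈ A, c j • l1e N (f j) ∈ l1cone N := by
  intro i
  rw [WithLp.ofLp_sum, Finset.sum_apply]
  refine Finset.sum_nonneg fun j _ => ?_
  have := l1e_apply N (f j) i
  simp only [PiLp.smul_apply, smul_eq_mul, this]
  have := hc j
  split_ifs <;> simp [this]

theorem pushMap_norm (n N : ℕ) (f : Fin n → Fin N) (x) : ‖pushMap n N f x‖ ≤ ‖x‖ := by
  rw [pushMap_apply, PiLp.norm_eq_of_L1 x]
  refine (norm_sum_le (E := PiLp 1 fun _ : Fin N => ℝ) _ _).trans (le_of_eq ?_)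
  simp [norm_smul, l1e_norm]

/-- symmetrized tensor `e_{f 1} ∨ ⋯ ∨ e_{f n}`. -/
def symE (n N : ℕ) (f : Fin n → Fin N) : ⨂[ℝ] (_ : Fin n), PiLp 1 fun _ : Fin N => ℝ :=
  (n.factorial : ℝ)⁻¹ • ∑ σ : Equiv.Perm (Fin n), ⨂ₜ[ℝ] i, l1e N (f (σ i))

theorem rep_symE (n N : ℕ) (f : Fin n → Fin N) {s : ℝ}
    (h : TRep (l1cone n) n (symE n n id) s) : TRep (l1cone N) n (symE n N f) s := by
  have := h.map (Q := l1cone N) (pushMap n N f) (fun x hx => sum_mem_cone _ _ _ hx _)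
    (pushMap_norm n N f)
  simpa [symE, PiTensorProduct.map_tprod, pushMap_e] using this

theorem polar_coeff (n : ℕ) (f : Fin n → Fin n) :
    ∑ T : Finset (Fin n), (-1 : ℝ) ^ T.card * ∏ i, (if f i ∈ T then (0 : ℝ) else 1) =
      if Function.Bijective f then 1 else 0 := by
  classical
  have h1 : ∀ T : Finset (Fin n), ∏ i, (if f i ∈ T then (0 : ℝ) else 1) =
      if T ⊆ (Finset.univ.image f)ᶜ then 1 else 0 := by
    intro T
    split_ifs with h
    · refine Finset.prod_eq_one fun i _ => ?_
      rw [if_neg]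
      intro hi
      have := h hi
      simp at this
    · rw [Finset.not_subset] at h
      obtain ⟨j, hj, hj'⟩ := h
      simp only [Finset.mem_compl, Finset.mem_image, Finset.mem_univ, true_and, not_not] at hj'
      obtain ⟨i, rfl⟩ := hj'
      exact Finset.prod_eq_zero (Finset.mem_univ i) (by simp [hj])
  simp only [h1, mul_ite, mul_one, mul_zero]
  rw [← Finset.sum_filter]
  have h2 : (Finset.univ.filter fun T : Finset (Fin n) => T ⊆ (Finset.univ.image f)ᶜ) =
      ((Finset.univ.image f)ᶜ).powerset := by
    ext T; simp
  rw [h2]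
  have h3 := Finset.sum_powerset_neg_one_pow_card (x := (Finset.univ.image f)ᶜ)
  have h4 : (∑ T ∈ ((Finset.univ.image f)ᶜ).powerset, (-1 : ℝ) ^ T.card) =
      ((if (Finset.univ.image f)ᶜ = ∅ then 1 else 0 : ℤ) : ℝ) := by
    rw [← h3]; push_cast; rfl
  rw [h4]
  have h5 : (Finset.univ.image f)ᶜ = ∅ ↔ Function.Bijective f := by
    rw [← Finite.surjective_iff_bijective, Finset.compl_eq_empty_iff, Finset.eq_univ_iff_forall]
    simp [Function.Surjective]
  simp only [h5]
  split_ifs <;> simp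

theorem sum_perm_eq {M : Type*} [AddCommMonoid M] (n : ℕ) (g : (Fin n → Fin n) → M) :
    ∑ f : Fin n → Fin n with Function.Bijective f, g f = ∑ σ : Equiv.Perm (Fin n), g σ := by
  classical
  symm
  refine Finset.sum_bij (fun σ _ => ⇑σ) ?_ ?_ ?_ ?_
  · intro σ _; exact Finset.mem_filter.2 ⟨Finset.mem_univ _, σ.bijective⟩
  · intro a _ b _ h; exact DFunLike.coe_injective h
  · intro f hf
    simp only [Finset.mem_filter, Finset.mem_univ, true_and] at hf
    exact ⟨Equiv.ofBijective f hf, by simp, rfl⟩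
  · intro σ _; rfl

theorem sum_emb_eq {M : Type*} [AddCommMonoid M] (n N : ℕ) (g : (Fin n → Fin N) → M) :
    ∑ f : Fin n → Fin N with Function.Injective f, g f = ∑ σ : Fin n ↪ Fin N, g σ := by
  classical
  symm
  refine Finset.sum_bij (fun σ _ => ⇑σ) ?_ ?_ ?_ ?_
  · intro σ _; simp [σ.injective]
  · intro a _ b _ h; exact DFunLike.coe_injective h
  · intro f hf
    simp only [Finset.mem_filter, Finset.mem_univ, true_and] at hf
    exact ⟨⟨f, hf⟩, by simp, rfl⟩
  · intro σ _; rfl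

theorem tprod_sum (n N : ℕ) (c : Fin N → ℝ) :
    (⨂ₜ[ℝ] (_ : Fin n), ∑ j, c j • l1e N j) =
      ∑ f : Fin n → Fin N, (∏ i, c (f i)) • ⨂ₜ[ℝ] i, l1e N (f i) := by
  rw [MultilinearMap.map_sum]
  refine Finset.sum_congr rfl fun f _ => ?_
  rw [MultilinearMap.map_smul_univ]

theorem exists_rep (n : ℕ) : ∃ s, TRep (l1cone n) n (symE n n id) s := by
  classical
  have h : (∑ σ : Equiv.Perm (Fin n), ⨂ₜ[ℝ] i, l1e n (σ i)) =
      ∑ T : Finset (Fin n), (-1 : ℝ) ^ T.card •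
        ⨂ₜ[ℝ] (_ : Fin n), ∑ j, (if j ∈ T then (0 : ℝ) else 1) • l1e n j := by
    simp only [tprod_sum, Finset.smul_sum, smul_smul]
    rw [Finset.sum_comm]
    simp only [← Finset.sum_smul, polar_coeff, ite_smul, one_smul, zero_smul]
    rw [← Finset.sum_filter]
    exact (sum_perm_eq n fun f => ⨂ₜ[ℝ] i, l1e n (f i)).symm
  refine ⟨_, TRep.smul (s := ?_) _ ?_⟩
  · exact ∑ T : Finset (Fin n), |(-1 : ℝ) ^ T.card| *
      ‖∑ j, (if j ∈ T then (0 : ℝ) else 1) • l1e n j‖ ^ n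
  · simp only [id]
    rw [h]
    refine TRep.sum _ _ _ fun T _ => TRep.smul _ (TRep.single ?_)
    exact sum_mem_cone _ _ _ (fun i => by split_ifs <;> simp) _

theorem sum_symE (n N : ℕ) :
    ∑ f : Fin n → Fin N with ¬ Function.Injective f, symE n N f =
    ∑ f : Fin n → Fin N with ¬ Function.Injective f, ⨂ₜ[ℝ] i, l1e N (f i) := by
  simp only [symE]
  rw [← Finset.smul_sum, Finset.sum_comm]
  have : ∀ σ : Equiv.Perm (Fin n),
      ∑ f : Fin n → Fin N with ¬ Function.Injective f, (⨂ₜ[ℝ] i, l1e N (f (σ i))) =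
      ∑ f : Fin n → Fin N with ¬ Function.Injective f, ⨂ₜ[ℝ] i, l1e N (f i) := by
    intro σ
    refine Finset.sum_equiv (σ.symm.arrowCongr (Equiv.refl _)) ?_ ?_
    · intro f
      have : (σ.symm.arrowCongr (Equiv.refl (Fin N))) f = f ∘ σ := by ext; simp
      simp [this]
    · intro f _
      simp
  simp only [this, Finset.sum_const, Finset.card_univ, Fintype.card_perm, Fintype.card_fin]
  rw [← Nat.cast_smul_eq_nsmul ℝ, smul_smul, inv_mul_cancel₀, one_smul]
  exact_mod_cast n.factorial_ne_zero

theorem desc_bound (N n : ℕ) (hn : n ≤ N) :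
    (N : ℝ) ^ n * (2 * N - n * (n - 1)) ≤ 2 * N * N.descFactorial n := by
  induction n with
  | zero => simp
  | succ n ih =>
    have ih := ih (by omega)
    have h1 : (N.descFactorial n : ℝ) ≤ N ^ n := by exact_mod_cast Nat.descFactorial_le_pow N n
    rw [Nat.descFactorial_succ]
    push_cast [Nat.cast_sub (show n ≤ N by omega)]
    have h2 := mul_le_mul_of_nonneg_left ih (Nat.cast_nonneg (α := ℝ) N)
    have h3 := mul_le_mul_of_nonneg_left h1 (show (0 : ℝ) ≤ 2 * N * n by positivity)
    rw [pow_succ]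
    nlinarith

theorem rep_chi (n N : ℕ) (hnN : n ≤ N) {s : ℝ} (h : TRep (l1cone n) n (symE n n id) s) :
    TRep (l1cone N) n (chiTensor n N)
      ((N.descFactorial n : ℝ)⁻¹ * (N ^ n + (N ^ n - N.descFactorial n) * s)) := by
  have hM : ((N - n).factorial : ℝ) / (N.factorial : ℝ) = (N.descFactorial n : ℝ)⁻¹ := by
    rw [← Nat.factorial_mul_descFactorial hnN]
    have := (N - n).factorial_ne_zero
    push_cast
    field_simp
  have hcard : ((Finset.univ.filter fun f : Fin n → Fin N => ¬ Function.Injective f).card : ℝ) =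
      N ^ n - N.descFactorial n := by
    have h1 := Finset.card_filter_add_card_filter_not (s := (Finset.univ : Finset (Fin n → Fin N)))
      (fun f => Function.Injective f)
    have h2 : (Finset.univ.filter fun f : Fin n → Fin N => Function.Injective f).card =
        N.descFactorial n := by
      have := sum_emb_eq n N (fun _ => 1)
      simpa [Fintype.card_embedding_eq] using this
    rw [h2] at h1
    simp only [Finset.card_univ, Fintype.card_fun, Fintype.card_fin] at h1
    rw [eq_sub_iff_add_eq, add_comm]
    exact_mod_cast h1
  have h1 : TRep (l1cone N) n (⨂ₜ[ℝ] (_ : Fin n), ∑ j, (1 : ℝ) • l1e N j) ((N : ℝ) ^ n) := by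
    refine (TRep.single (sum_mem_cone _ _ _ (fun _ => zero_le_one) _)).mono ?_
    gcongr
    refine (norm_sum_le (E := PiLp 1 fun _ : Fin N => ℝ) _ _).trans (le_of_eq ?_)
    simp [l1e_norm]
  have h2 := TRep.sum (Finset.univ.filter fun f : Fin n → Fin N => ¬ Function.Injective f)
    (symE n N) (fun _ => s) (fun f _ => rep_symE n N f h)
  rw [sum_symE, Finset.sum_const, nsmul_eq_mul, hcard] at h2
  have h3 := (h1.add (h2.smul (-1))).smul (N.descFactorial n : ℝ)⁻¹
  rw [chiTensor, hM]
  convert h3 using 2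
  · rw [tprod_sum, ← Finset.sum_filter_add_sum_filter_not Finset.univ
      (fun f : Fin n → Fin N => Function.Injective f), ← sum_emb_eq n N fun f => ⨂ₜ[ℝ] i, l1e N (f i)]
    simp
  · simp
  · simp

/-- If `1 ≤ n ≤ N` and `N > n(n−1)/2`, then
`κ(n,N) ≤ 1 + (n(n−1)/(2N − n(n−1)))·(κ(n)+1)`. -/
theorem kappaNN_upper (n N : ℕ) (hn : 1 ≤ n) (hnN : n ≤ N)
    (hN : (n : ℝ) * ((n : ℝ) - 1) / 2 < N) :
    kappaNN n N ≤
      1 + ((n : ℝ) * ((n : ℝ) - 1) / (2 * (N : ℝ) - (n : ℝ) * ((n : ℝ) - 1))) * (kappa n + 1) := by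
  have hN0 : (0 : ℝ) < N := by exact_mod_cast (by omega : 0 < N)
  have hM : (0 : ℝ) < N.descFactorial n := by
    exact_mod_cast Nat.descFactorial_pos.2 hnN
  have hD : (0 : ℝ) < 2 * N - n * (n - 1) := by linarith
  have hn1 : (0 : ℝ) ≤ n * (n - 1) := by
    have : (1 : ℝ) ≤ n := by exact_mod_cast hn
    nlinarith
  have hb := desc_bound N n hnN
  set r : ℝ := (n : ℝ) * ((n : ℝ) - 1) / (2 * (N : ℝ) - (n : ℝ) * ((n : ℝ) - 1)) with hr
  have hr0 : 0 ≤ r := by positivity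
  have hq : ((N : ℝ) ^ n - N.descFactorial n) / N.descFactorial n ≤ r := by
    rw [hr, div_le_div_iff₀ hM hD]
    linarith
  have key : ∀ s, TRep (l1cone n) n (symE n n id) s → kappaNN n N ≤ 1 + r * (s + 1) := by
    intro s hs
    have h1 := (rep_chi n N hnN hs).norm_le
    have h0 := hs.nonneg
    have h2 : (N.descFactorial n : ℝ)⁻¹ * (N ^ n + (N ^ n - N.descFactorial n) * s) =
        1 + ((N : ℝ) ^ n - N.descFactorial n) / N.descFactorial n * (s + 1) := by
      field_simp
      ring
    rw [h2] at h1
    refine h1.trans ?_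
    gcongr
  obtain ⟨s₀, hs₀⟩ := exists_rep n
  rcases hr0.eq_or_lt with h | h
  · have := key s₀ hs₀
    rw [← h] at this ⊢
    linarith
  · have : (kappaNN n N - 1) / r - 1 ≤ kappa n := by
      refine le_norm_of_TRep ⟨s₀, hs₀⟩ fun s hs => ?_
      have := key s hs
      rw [sub_le_iff_le_add, div_le_iff₀ h]
      linarith
    rw [sub_le_iff_le_add, div_le_iff₀ h] at this
    linarith

end
end
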